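/- arXiv:2106.09425 — 2 statements merged into one kernel-verified Lean document; each statement's English description precedes it below -/
import Mathlib

section
/- Let l and l′ be two lists of transpositions of Fin n of the same length, such that the entries of l generate the full symmetric group of Fin n (Subgroup.closure of the set of entries equals ⊤), the entries of l′ also generate the full symmetric group, and l.prod = l′.prod. Then l and l′ are connected by standard moves. -/
/-- A single standard move on a list of elements of a group: an adjacent pair `(a, b)`
is replaced by `(b, b⁻¹ * a * b)` or by `(a * b * a⁻¹, a)`. -/
def StandardMove {G : Type*} [Group G] (l l' : List G) : Prop :=
  ∃ (l₁ l₂ : List G) (a b : G),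
    l = l₁ ++ a :: b :: l₂ ∧
    (l' = l₁ ++ b :: (b⁻¹ * a * b) :: l₂ ∨ l' = l₁ ++ (a * b * a⁻¹) :: a :: l₂)

/-- Two lists are connected by standard moves. -/
def StdConnected {G : Type*} [Group G] : List G → List G → Prop :=
  Relation.ReflTransGen StandardMove

section Doubled

variable {G : Type*}

/-- The list in which every entry of `t` is repeated twice in a row. -/
def doubled (t : List G) : List G := t.flatMap fun x => [x, x]

@[simp] theorem doubled_nil : doubled ([] : List G) = [] := rfl

@[simp] theorem doubled_cons (x : G) (t : List G) : doubled (x :: t) = x :: x :: doubled t := rfl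

@[simp] theorem doubled_append (s t : List G) : doubled (s ++ t) = doubled s ++ doubled t := by
  simp [doubled]

@[simp] theorem mem_doubled {x : G} {t : List G} : x ∈ doubled t ↔ x ∈ t := by
  simp [doubled]

theorem length_doubled (t : List G) : (doubled t).length = 2 * t.length := by
  induction t with
  | nil => rfl
  | cons x t ih => simp [ih]; ring

end Doubled

section General

variable {G : Type*} [Group G]

theorem StandardMove.symm {l l' : List G} (h : StandardMove l l') : StandardMove l' l := by
  obtain ⟨x, y, a, b, rfl, rfl | rfl⟩ := h
  · exact ⟨x, y, b, b⁻¹ * a * b, rfl, Or.inr (by simp [mul_assoc])⟩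
  · exact ⟨x, y, a * b * a⁻¹, a, rfl, Or.inl (by simp [mul_assoc])⟩

theorem StandardMove.append {l l' : List G} (h : StandardMove l l') (u v : List G) :
    StandardMove (u ++ l ++ v) (u ++ l' ++ v) := by
  obtain ⟨x, y, a, b, rfl, rfl | rfl⟩ := h
  · exact ⟨u ++ x, y ++ v, a, b, by simp, Or.inl (by simp)⟩
  · exact ⟨u ++ x, y ++ v, a, b, by simp, Or.inr (by simp)⟩

theorem StandardMove.prod_eq {l l' : List G} (h : StandardMove l l') : l'.prod = l.prod := by
  obtain ⟨x, y, a, b, rfl, rfl | rfl⟩ := h <;> simp [mul_assoc]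

theorem StandardMove.length_eq {l l' : List G} (h : StandardMove l l') :
    l'.length = l.length := by
  obtain ⟨x, y, a, b, rfl, rfl | rfl⟩ := h <;> simp

theorem StandardMove.closure_le {l l' : List G} (h : StandardMove l l') :
    Subgroup.closure {g | g ∈ l'} ≤ Subgroup.closure {g | g ∈ l} := by
  obtain ⟨x, y, a, b, rfl, h⟩ := h
  have mem : ∀ g ∈ x ++ a :: b :: y,
      g ∈ Subgroup.closure {g | g ∈ x ++ a :: b :: y} := fun g hg => Subgroup.subset_closure hg
  have ha := mem a (by simp)
  have hb := mem b (by simp)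
  rw [Subgroup.closure_le]
  rcases h with rfl | rfl <;> intro g hg <;>
    simp only [Set.mem_ofPred_eq, List.mem_append, List.mem_cons] at hg
  · rcases hg with hg | rfl | rfl | hg
    · exact mem g (by simp [hg])
    · exact hb
    · exact mul_mem (mul_mem (inv_mem hb) ha) hb
    · exact mem g (by simp [hg])
  · rcases hg with hg | rfl | rfl | hg
    · exact mem g (by simp [hg])
    · exact mul_mem (mul_mem ha hb) (inv_mem ha)
    · exact ha
    · exact mem g (by simp [hg])

namespace StdConnected

theorem refl (l : List G) : StdConnected l l := Relation.ReflTransGen.refl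

theorem trans {l l' l'' : List G} (h : StdConnected l l') (h' : StdConnected l' l'') :
    StdConnected l l'' := Relation.ReflTransGen.trans h h'

theorem symm {l l' : List G} (h : StdConnected l l') : StdConnected l' l := by
  induction h with
  | refl => exact refl _
  | tail _ h ih => exact Relation.ReflTransGen.head h.symm ih

theorem append {l l' : List G} (h : StdConnected l l') (u v : List G) :
    StdConnected (u ++ l ++ v) (u ++ l' ++ v) := by
  induction h with
  | refl => exact refl _
  | tail _ h ih => exact Relation.ReflTransGen.tail ih (h.append u v)

theorem append_left {l l' : List G} (u : List G) (h : StdConnected l l') :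
    StdConnected (u ++ l) (u ++ l') := by
  simpa using h.append u []

theorem append_right {l l' : List G} (h : StdConnected l l') (v : List G) :
    StdConnected (l ++ v) (l' ++ v) := by
  simpa using h.append [] v

theorem prod_eq {l l' : List G} (h : StdConnected l l') : l'.prod = l.prod := by
  induction h with
  | refl => rfl
  | tail _ h ih => rw [h.prod_eq, ih]

theorem length_eq {l l' : List G} (h : StdConnected l l') : l'.length = l.length := by
  induction h with
  | refl => rfl
  | tail _ h ih => rw [h.length_eq, ih]

theorem closure_le {l l' : List G} (h : StdConnected l l') :
    Subgroup.closure {g | g ∈ l'} ≤ Subgroup.closure {g | g ∈ l} := by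
  induction h with
  | refl => rfl
  | tail _ h ih => exact h.closure_le.trans ih

theorem swap_left (a b : G) : StdConnected [a, b] [b, b⁻¹ * a * b] :=
  Relation.ReflTransGen.single ⟨[], [], a, b, rfl, Or.inl rfl⟩

theorem swap_right (a b : G) : StdConnected [a, b] [a * b * a⁻¹, a] :=
  Relation.ReflTransGen.single ⟨[], [], a, b, rfl, Or.inr rfl⟩

/-- An adjacent pair of equal involutions can be moved past any element. -/
theorem pair_comm_singleton {p : G} (hp : p * p = 1) (a : G) :
    StdConnected [p, p, a] [a, p, p] := by
  have h₁ : StdConnected [p, p, a] [p, p * a * p⁻¹, p] := (swap_right p a).append_left [p]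
  have h₂ : StdConnected [p, p * a * p⁻¹, p] [p * (p * a * p⁻¹) * p⁻¹, p, p] :=
    (swap_right p (p * a * p⁻¹)).append_right [p]
  have h : p * (p * a * p⁻¹) * p⁻¹ = a := by
    have : p⁻¹ = p := inv_eq_of_mul_eq_one_left hp
    rw [this]
    calc p * (p * a * p) * p = (p * p) * a * (p * p) := by group
      _ = a := by simp [hp]
  rw [h] at h₂
  exact h₁.trans h₂

theorem pair_comm {p : G} (hp : p * p = 1) (l : List G) :
    StdConnected (p :: p :: l) (l ++ [p, p]) := by
  induction l with
  | nil => exact refl _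
  | cons a l ih =>
    exact ((pair_comm_singleton hp a).append_right l).trans (ih.append_left [a])

theorem pair_conj_singleton {p : G} (hp : p * p = 1) (a : G) :
    StdConnected [p, p, a] [a * p * a⁻¹, a * p * a⁻¹, a] :=
  (pair_comm_singleton hp a).trans
    (((swap_right a p).append_right [p]).trans ((swap_right a p).append_left [a * p * a⁻¹]))

/-- A pair of equal involutions can be conjugated by anything generated by the other entries. -/
theorem pair_conj {l : List G} {g : G} (hg : g ∈ Subgroup.closure {τ | τ ∈ l}) :
    ∀ {p : G}, p * p = 1 →
      StdConnected (p :: p :: l) (g * p * g⁻¹ :: g * p * g⁻¹ :: l) := by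
  have conj_sq : ∀ a p : G, p * p = 1 → a * p * a⁻¹ * (a * p * a⁻¹) = 1 := by
    intro a p hp
    calc a * p * a⁻¹ * (a * p * a⁻¹) = a * (p * p) * a⁻¹ := by group
      _ = 1 := by simp [hp]
  induction hg using Subgroup.closure_induction with
  | mem a ha =>
    intro p hp
    obtain ⟨x, y, rfl⟩ := List.append_of_mem ha
    have h₁ := (pair_comm hp x).append_right (a :: y)
    have h₂ := (pair_conj_singleton hp a).append x y
    have h₃ := (pair_comm (conj_sq a p hp) x).symm.append_right (a :: y)
    simp only [List.append_assoc, List.cons_append, List.nil_append] at h₁ h₂ h₃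
    exact h₁.trans (h₂.trans h₃)
  | one => intro p _; simpa using refl _
  | mul a b _ _ iha ihb =>
    intro p hp
    have := (ihb hp).trans (iha (conj_sq b p hp))
    simpa [mul_assoc] using this
  | inv a _ ih =>
    intro p hp
    have := (ih (conj_sq a⁻¹ p hp)).symm
    simpa [mul_assoc] using this

end StdConnected

theorem prod_doubled {t : List G} (ht : ∀ x ∈ t, x * x = 1) : (doubled t).prod = 1 := by
  induction t with
  | nil => rfl
  | cons x t ih =>
    have hx := ht x (by simp)
    rw [doubled_cons, List.prod_cons, List.prod_cons, ih fun y hy => ht y (by simp [hy]), mul_one, hx]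

namespace StdConnected

theorem doubled_comm {t : List G} (ht : ∀ x ∈ t, x * x = 1) (l : List G) :
    StdConnected (doubled t ++ l) (l ++ doubled t) := by
  induction t generalizing l with
  | nil => simpa using refl _
  | cons x t ih =>
    have h₁ := (ih (fun y hy => ht y (by simp [hy])) l).append_left [x, x]
    have h₂ := (pair_comm (ht x (by simp)) l).append_right (doubled t)
    simpa using h₁.trans h₂

theorem doubled_perm {s t : List G} (h : s.Perm t) (hs : ∀ x ∈ s, x * x = 1) :
    StdConnected (doubled s) (doubled t) := by
  induction h with
  | nil => exact refl _
  | cons x _ ih => exact (ih fun y hy => hs y (by simp [hy])).append_left [x, x]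
  | swap x y l => exact (pair_comm (hs y (by simp)) [x, x]).append_right (doubled l)
  | trans h₁ _ ih₁ ih₂ => exact (ih₁ hs).trans (ih₂ fun y hy => hs y (h₁.mem_iff.2 hy))

end StdConnected

end General

section Swaps

open Equiv

variable {α : Type*} [DecidableEq α]

theorem Equiv.Perm.IsSwap.mul_self {τ : Perm α} (h : τ.IsSwap) : τ * τ = 1 := by
  obtain ⟨x, y, _, rfl⟩ := h
  exact swap_mul_self x y

theorem conj_swap (g : Perm α) (x y : α) : g * swap x y * g⁻¹ = swap (g x) (g y) := by
  rw [← Equiv.swap_apply_apply]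

theorem Equiv.Perm.IsSwap.conj {τ : Perm α} (h : τ.IsSwap) (g : Perm α) :
    (g * τ * g⁻¹).IsSwap := by
  obtain ⟨x, y, hxy, rfl⟩ := h
  exact ⟨g x, g y, g.injective.ne hxy, conj_swap g x y⟩

theorem StandardMove.isSwap {l l' : List (Perm α)} (h : StandardMove l l')
    (hl : ∀ τ ∈ l, τ.IsSwap) : ∀ τ ∈ l', τ.IsSwap := by
  obtain ⟨x, y, a, b, rfl, h⟩ := h
  have ha := hl a (by simp)
  have hb := hl b (by simp)
  have h₁ := ha.conj b⁻¹
  rw [inv_inv] at h₁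
  have h₂ := hb.conj a
  simp only [List.mem_append, List.mem_cons] at hl
  rcases h with rfl | rfl <;> intro τ hτ <;> simp only [List.mem_append, List.mem_cons] at hτ <;>
    grind

theorem StdConnected.isSwap {l l' : List (Perm α)} (h : StdConnected l l')
    (hl : ∀ τ ∈ l, τ.IsSwap) : ∀ τ ∈ l', τ.IsSwap := by
  induction h with
  | refl => exact hl
  | tail _ h ih => exact h.isSwap ih

theorem swap_mem_trans {H : Subgroup (Perm α)} {x y z : α} (hxy : swap x y ∈ H)
    (hyz : swap y z ∈ H) : swap x z ∈ H := by
  by_cases h₁ : x = y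
  · rwa [h₁]
  by_cases h₂ : x = z
  · rw [h₂, swap_self]; exact one_mem H
  have h := mul_mem (mul_mem hyz hxy) (inv_mem hyz)
  rwa [conj_swap, swap_apply_of_ne_of_ne h₁ h₂, swap_apply_left] at h

theorem exists_conj_swap {H : Subgroup (Perm α)} {x y u v : α} (hxy : x ≠ y) (huv : u ≠ v)
    (hu : swap u x ∈ H) (hv : swap v y ∈ H) :
    ∃ g ∈ H, g * swap u v * g⁻¹ = swap x y := by
  by_cases h : v = x
  · subst h
    refine ⟨swap u y, swap_mem_trans hu hv, ?_⟩
    rw [conj_swap, swap_apply_left, swap_apply_of_ne_of_ne huv.symm hxy, swap_comm]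
  · refine ⟨swap v y * swap u x, mul_mem hv hu, ?_⟩
    rw [conj_swap, Perm.mul_apply, Perm.mul_apply, swap_apply_left,
      swap_apply_of_ne_of_ne huv.symm h, swap_apply_left,
      swap_apply_of_ne_of_ne (Ne.symm h) hxy]

/-- If adding one transposition `τ` to a list of transpositions brings `swap x y` into the
generated subgroup, then `τ` joins the class of `x` to the class of `y`. -/
theorem swap_mem_closure_cons {m : List (Perm α)} (hm : ∀ τ ∈ m, τ.IsSwap) {u v x y : α}
    (h : swap x y ∈ Subgroup.closure {τ | τ ∈ swap u v :: m}) :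
    swap x y ∈ Subgroup.closure {τ | τ ∈ m} ∨
      (swap u x ∈ Subgroup.closure {τ | τ ∈ m} ∧ swap v y ∈ Subgroup.closure {τ | τ ∈ m}) ∨
      (swap v x ∈ Subgroup.closure {τ | τ ∈ m} ∧ swap u y ∈ Subgroup.closure {τ | τ ∈ m}) := by
  set H := Subgroup.closure {τ | τ ∈ m} with hH
  have tr : ∀ {a b c : α}, swap a b ∈ H → swap b c ∈ H → swap a c ∈ H := swap_mem_trans
  have sy : ∀ {a b : α}, swap a b ∈ H → swap b a ∈ H := fun {a b} h => by rwa [swap_comm]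
  have rf : ∀ a : α, swap a a ∈ H := fun a => by rw [swap_self]; exact one_mem H
  have key : ∀ g ∈ Subgroup.closure {τ | τ ∈ swap u v :: m}, ∀ p : α,
      swap p (g p) ∈ H ∨ (swap u p ∈ H ∧ swap v (g p) ∈ H) ∨
        (swap v p ∈ H ∧ swap u (g p) ∈ H) := by
    intro g hg
    induction hg using Subgroup.closure_induction with
    | mem τ hτ =>
      intro p
      rcases List.mem_cons.1 hτ with rfl | hτ
      · by_cases h₁ : p = u
        · subst h₁; rw [swap_apply_left]; exact Or.inr (Or.inl ⟨rf _, rf _⟩)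
        by_cases h₂ : p = v
        · subst h₂; rw [swap_apply_right]; exact Or.inr (Or.inr ⟨rf _, rf _⟩)
        rw [swap_apply_of_ne_of_ne h₁ h₂]; exact Or.inl (rf _)
      · left
        have hmem : τ ∈ H := Subgroup.subset_closure hτ
        obtain ⟨a, b, _, rfl⟩ := hm τ hτ
        by_cases h₁ : p = a
        · subst h₁; rwa [swap_apply_left]
        by_cases h₂ : p = b
        · subst h₂; rw [swap_apply_right]; exact sy hmem
        rw [swap_apply_of_ne_of_ne h₁ h₂]; exact rf _
    | one => intro p; exact Or.inl (rf _)
    | mul a b _ _ iha ihb =>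
      intro p
      have h₁ := ihb p
      have h₂ := iha (b p)
      rw [Perm.mul_apply]
      generalize a (b p) = r at *
      generalize b p = q at *
      clear hm h iha ihb
      rcases h₁ with h₁ | ⟨h₁, h₁'⟩ | ⟨h₁, h₁'⟩ <;> rcases h₂ with h₂ | ⟨h₂, h₂'⟩ | ⟨h₂, h₂'⟩
      · exact Or.inl (tr h₁ h₂)
      · exact Or.inr (Or.inl ⟨tr h₂ (sy h₁), h₂'⟩)
      · exact Or.inr (Or.inr ⟨tr h₂ (sy h₁), h₂'⟩)
      · exact Or.inr (Or.inl ⟨h₁, tr h₁' h₂⟩)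
      · exact Or.inr (Or.inl ⟨h₁, h₂'⟩)
      · exact Or.inl (tr (sy h₁) h₂')
      · exact Or.inr (Or.inr ⟨h₁, tr h₁' h₂⟩)
      · exact Or.inl (tr (sy h₁) h₂')
      · exact Or.inr (Or.inr ⟨h₁, h₂'⟩)
    | inv a _ ih =>
      intro p
      have h₁ := ih (a⁻¹ p)
      rw [show a (a⁻¹ p) = p from a.apply_symm_apply p] at h₁
      rcases h₁ with h₁ | ⟨h₁, h₁'⟩ | ⟨h₁, h₁'⟩
      · exact Or.inl (sy h₁)
      · exact Or.inr (Or.inr ⟨h₁', h₁⟩)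
      · exact Or.inr (Or.inl ⟨h₁', h₁⟩)
  simpa using key _ h x

/-- Exchange property: if the transpositions of `t` are needed to generate `swap x y`, then one of
them is conjugate to `swap x y` under the subgroup generated by all the others. -/
theorem exists_exchange {m t : List (Perm α)} (hm : ∀ τ ∈ m, τ.IsSwap) (ht : ∀ τ ∈ t, τ.IsSwap)
    {x y : α} (hx : swap x y ∉ Subgroup.closure {τ | τ ∈ m})
    (hmem : swap x y ∈ Subgroup.closure {τ | τ ∈ m ++ t}) :
    ∃ τ t', t.Perm (τ :: t') ∧
      ∃ g ∈ Subgroup.closure {τ | τ ∈ m ++ t'}, g * τ * g⁻¹ = swap x y := by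
  induction t generalizing m with
  | nil => simp only [List.append_nil] at hmem; exact absurd hmem hx
  | cons τ t ih =>
    have hτ := ht τ (by simp)
    have hmτ : ∀ σ ∈ τ :: m, σ.IsSwap := by
      intro σ hσ
      rcases List.mem_cons.1 hσ with rfl | hσ
      exacts [hτ, hm σ hσ]
    by_cases h : swap x y ∈ Subgroup.closure {σ | σ ∈ τ :: m}
    · refine ⟨τ, t, List.Perm.refl _, ?_⟩
      have hle : Subgroup.closure {σ | σ ∈ m} ≤ Subgroup.closure {σ | σ ∈ m ++ t} :=
        Subgroup.closure_mono fun σ hσ => List.mem_append_left t hσ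
      have hxy : x ≠ y := by
        rintro rfl
        rw [swap_self] at hx
        exact hx (one_mem _)
      obtain ⟨u, v, huv, rfl⟩ := hτ
      rcases swap_mem_closure_cons hm h with h | ⟨h₁, h₂⟩ | ⟨h₁, h₂⟩
      · exact absurd h hx
      · exact exists_conj_swap hxy huv (hle h₁) (hle h₂)
      · rw [swap_comm u v]
        exact exists_conj_swap hxy huv.symm (hle h₁) (hle h₂)
    · obtain ⟨σ, t', hperm, g, hg, hgσ⟩ := ih hmτ (fun σ hσ => ht σ (by simp [hσ])) h (by
        convert hmem using 3
        ext; simp only [List.mem_append, List.mem_cons]; tauto)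
      refine ⟨σ, τ :: t', (hperm.cons τ).trans (List.Perm.swap _ _ _), g, ?_, hgσ⟩
      convert hg using 3
      ext; simp only [List.mem_append, List.mem_cons]; tauto

/-- Lists with the same initial part, followed by doubled transpositions, are connected as soon as
they both generate the full group. -/
theorem stdConnected_append_doubled {m s t : List (Perm α)} (hm : ∀ τ ∈ m, τ.IsSwap)
    (hs : ∀ τ ∈ s, τ.IsSwap) (ht : ∀ τ ∈ t, τ.IsSwap) (hlen : t.length = s.length)
    (hgs : Subgroup.closure {τ | τ ∈ m ++ s} = ⊤) (hgt : Subgroup.closure {τ | τ ∈ m ++ t} = ⊤) :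
    StdConnected (m ++ doubled t) (m ++ doubled s) := by
  induction hk : s.length generalizing m s t with
  | zero =>
    rw [hk] at hlen
    rw [List.length_eq_zero_iff.1 hk, List.length_eq_zero_iff.1 hlen]
    exact .refl _
  | succ k ih =>
    have key : ∃ σ s', s.Perm (σ :: s') ∧ ∃ τ t', t.Perm (τ :: t') ∧
        ∃ g ∈ Subgroup.closure {τ | τ ∈ m ++ t'}, g * τ * g⁻¹ = σ := by
      by_cases h : ∀ σ ∈ s, σ ∈ Subgroup.closure {τ | τ ∈ m}
      · have htop : Subgroup.closure {τ | τ ∈ m} = ⊤ := by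
          rw [eq_top_iff, ← hgs, Subgroup.closure_le]
          intro σ hσ
          rcases List.mem_append.1 hσ with hσ | hσ
          exacts [Subgroup.subset_closure hσ, h σ hσ]
        obtain ⟨σ, s', rfl⟩ := List.exists_cons_of_length_eq_add_one hk
        obtain ⟨τ, t', rfl⟩ := List.exists_cons_of_length_eq_add_one (hlen.trans hk)
        refine ⟨σ, s', List.Perm.refl _, τ, t', List.Perm.refl _, ?_⟩
        have hle : Subgroup.closure {σ | σ ∈ m} ≤ Subgroup.closure {σ | σ ∈ m ++ t'} :=
          Subgroup.closure_mono fun σ hσ => List.mem_append_left t' hσ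
        obtain ⟨x, y, hxy, rfl⟩ := hs σ (by simp)
        obtain ⟨u, v, huv, rfl⟩ := ht τ (by simp)
        rw [htop] at hle
        exact exists_conj_swap hxy huv (hle trivial) (hle trivial)
      · push Not at h
        obtain ⟨σ, hσ, hσm⟩ := h
        obtain ⟨x, y, _, rfl⟩ := hs σ hσ
        obtain ⟨s₁, s₂, rfl⟩ := List.append_of_mem hσ
        exact ⟨_, _, List.perm_middle, exists_exchange hm ht hσm (hgt ▸ trivial)⟩
    obtain ⟨σ, s', hps, τ, t', hpt, g, hg, hgτ⟩ := key
    have hsσ : ∀ x ∈ σ :: s', x.IsSwap := fun x hx => hs x (hps.mem_iff.2 hx)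
    have htτ : ∀ x ∈ τ :: t', x.IsSwap := fun x hx => ht x (hpt.mem_iff.2 hx)
    have hσ := hsσ σ (by simp)
    have hτ := htτ τ (by simp)
    have c₁ := (StdConnected.doubled_perm hpt fun x hx => (ht x hx).mul_self).append_left m
    have c₅ := (StdConnected.doubled_perm hps fun x hx => (hs x hx).mul_self).symm.append_left m
    have c₂ := (StdConnected.pair_comm hτ.mul_self m).symm.append_right (doubled t')
    have c₃ : StdConnected (τ :: τ :: (m ++ doubled t')) (σ :: σ :: (m ++ doubled t')) := by
      rw [← hgτ]
      refine StdConnected.pair_conj ?_ hτ.mul_self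
      simpa using hg
    have c₃' := (StdConnected.pair_comm hσ.mul_self m).append_right (doubled t')
    have hconj : StdConnected (m ++ doubled t) (m ++ [σ, σ] ++ doubled t') := by
      simp only [doubled_cons, List.append_assoc, List.cons_append, List.nil_append]
        at c₁ c₂ c₃ c₃' ⊢
      exact c₁.trans (c₂.trans (c₃.trans c₃'))
    have c₄ : StdConnected (m ++ [σ, σ] ++ doubled t') (m ++ [σ, σ] ++ doubled s') := by
      have hl₁ := hps.length_eq
      have hl₂ := hpt.length_eq
      simp only [List.length_cons] at hl₁ hl₂
      refine ih ?_ (fun x hx => hsσ x (by simp [hx])) (fun x hx => htτ x (by simp [hx]))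
        (by omega) ?_ ?_ (by omega)
      · intro x hx
        simp only [List.mem_append, List.mem_cons, List.not_mem_nil, or_false, or_self] at hx
        rcases hx with hx | rfl
        exacts [hm x hx, hσ]
      · rw [← hgs]
        congr 1
        ext x
        simp only [List.mem_append, List.mem_cons, Set.mem_ofPred_eq, hps.mem_iff]
        simp; tauto
      · have h₁ := hconj.symm.closure_le
        rw [eq_top_iff, ← hgt]
        convert h₁ using 2
        · ext x; simp
        · ext x; simp
    simp only [doubled_cons, List.append_assoc, List.cons_append, List.nil_append]
      at c₄ c₅ hconj
    exact hconj.trans (c₄.trans c₅)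

/-- `τ` is a transposition of two points of `S`. -/
def IsSwapOn (S : Finset α) (τ : Perm α) : Prop := ∃ x ∈ S, ∃ y ∈ S, x ≠ y ∧ τ = swap x y

theorem IsSwapOn.isSwap {S : Finset α} {τ : Perm α} (h : IsSwapOn S τ) : τ.IsSwap := by
  obtain ⟨x, _, y, _, hxy, rfl⟩ := h
  exact ⟨x, y, hxy, rfl⟩

theorem IsSwapOn.apply_of_notMem {S : Finset α} {τ : Perm α} (h : IsSwapOn S τ) {a : α}
    (ha : a ∉ S) : τ a = a := by
  obtain ⟨x, hx, y, hy, _, rfl⟩ := h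
  exact swap_apply_of_ne_of_ne (fun h => ha (h ▸ hx)) (fun h => ha (h ▸ hy))

theorem IsSwapOn.apply_mem {S : Finset α} {τ : Perm α} (h : IsSwapOn S τ) {a : α}
    (ha : a ∈ S) : τ a ∈ S := by
  obtain ⟨x, hx, y, hy, _, rfl⟩ := h
  rw [swap_apply_def]
  split_ifs <;> assumption

theorem IsSwapOn.cases_insert {S : Finset α} {a : α} {τ : Perm α}
    (h : IsSwapOn (insert a S) τ) : IsSwapOn S τ ∨ ∃ b ∈ S, τ = swap a b := by
  obtain ⟨x, hx, y, hy, hxy, rfl⟩ := h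
  rcases Finset.mem_insert.1 hx with rfl | hx' <;> rcases Finset.mem_insert.1 hy with rfl | hy'
  · exact absurd rfl hxy
  · exact Or.inr ⟨y, hy', rfl⟩
  · exact Or.inr ⟨x, hx', swap_comm _ _⟩
  · exact Or.inl ⟨x, hx', y, hy', hxy, rfl⟩

theorem prod_apply_of_notMem {S : Finset α} {l : List (Perm α)} (hl : ∀ τ ∈ l, IsSwapOn S τ)
    {a : α} (ha : a ∉ S) : l.prod a = a := by
  induction l with
  | nil => rfl
  | cons τ l ih =>
    rw [List.prod_cons, Perm.mul_apply, ih fun σ hσ => hl σ (by simp [hσ]),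
      (hl τ (by simp)).apply_of_notMem ha]

/-- Up to standard moves and doubled transpositions, at most one entry involves the point `a`. -/
theorem exists_stdConnected_isolate {S : Finset α} {a : α} (ha : a ∉ S) {l : List (Perm α)}
    (hl : ∀ τ ∈ l, IsSwapOn (insert a S) τ) :
    ∃ A B t : List (Perm α), StdConnected l (A ++ B ++ doubled t) ∧ (∀ τ ∈ A, IsSwapOn S τ) ∧
      (∀ τ ∈ t, τ.IsSwap) ∧ (B = [] ∨ ∃ b ∈ S, B = [swap a b]) := by
  induction l using List.reverseRecOn with
  | nil => exact ⟨[], [], [], .refl _, by simp, by simp, Or.inl rfl⟩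
  | append_singleton l τ ih =>
    obtain ⟨A, B, t, hc, hA, ht, hB⟩ := ih fun σ hσ => hl σ (by simp [hσ])
    have c₁ := hc.append_right [τ]
    have c₂ := (StdConnected.doubled_comm (fun x hx => (ht x hx).mul_self) [τ]).append_left (A ++ B)
    have c : StdConnected (l ++ [τ]) (A ++ (B ++ [τ]) ++ doubled t) := by
      simp only [List.append_assoc] at c₁ c₂ ⊢
      exact c₁.trans c₂
    have hAcons : ∀ σ, IsSwapOn S σ → ∀ x ∈ A ++ [σ], IsSwapOn S x := by
      intro σ hσ x hx
      rcases List.mem_append.1 hx with hx | hx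
      · exact hA x hx
      · rwa [List.mem_singleton.1 hx]
    rcases (hl τ (by simp)).cases_insert with hτ | ⟨b', hb', rfl⟩
    · rcases hB with rfl | ⟨b, hb, rfl⟩
      · exact ⟨A ++ [τ], [], t, by simpa using c, hAcons τ hτ, ht, Or.inl rfl⟩
      · refine ⟨A ++ [τ], [swap a (τ b)], t, ?_, hAcons τ hτ, ht, Or.inr ⟨_, hτ.apply_mem hb, rfl⟩⟩
        have hinv : τ⁻¹ = τ := inv_eq_of_mul_eq_one_left hτ.isSwap.mul_self
        have h := StdConnected.swap_left (swap a b) τ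
        have e : τ⁻¹ * swap a b * τ = swap a (τ b) := by
          calc τ⁻¹ * swap a b * τ = τ * swap a b * τ⁻¹ := by rw [hinv]
            _ = swap a (τ b) := by rw [conj_swap, hτ.apply_of_notMem ha]
        rw [e] at h
        have h' := h.append A (doubled t)
        simp only [List.append_assoc, List.cons_append, List.nil_append] at c h' ⊢
        exact c.trans h'
    · rcases hB with rfl | ⟨b, hb, rfl⟩
      · exact ⟨A, [swap a b'], t, by simpa using c, hA, ht, Or.inr ⟨b', hb', rfl⟩⟩
      · have hab : a ≠ b := fun h => ha (h ▸ hb)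
        have hab' : a ≠ b' := fun h => ha (h ▸ hb')
        by_cases hbb : b = b'
        · subst hbb
          refine ⟨A, [], swap a b :: t, by simpa using c, hA, ?_, Or.inl rfl⟩
          intro x hx
          rcases List.mem_cons.1 hx with rfl | hx
          exacts [⟨a, b, hab, rfl⟩, ht x hx]
        · refine ⟨A ++ [swap b b'], [swap a b], t, ?_,
            hAcons _ ⟨b, hb, b', hb', hbb, rfl⟩, ht, Or.inr ⟨b, hb, rfl⟩⟩
          have h := StdConnected.swap_right (swap a b) (swap a b')
          rw [conj_swap, swap_apply_left, swap_apply_of_ne_of_ne hab'.symm (Ne.symm hbb)] at h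
          have h' := h.append A (doubled t)
          simp only [List.append_assoc, List.cons_append, List.nil_append] at c h' ⊢
          exact c.trans h'

/-- Up to standard moves, a list of transpositions is a list depending only on its product,
followed by doubled transpositions. -/
theorem exists_canonical (S : Finset α) :
    ∃ canon : Perm α → List (Perm α), ∀ l : List (Perm α), (∀ τ ∈ l, IsSwapOn S τ) →
      ∃ t, (∀ τ ∈ t, τ.IsSwap) ∧ StdConnected l (canon l.prod ++ doubled t) := by
  induction S using Finset.induction_on with
  | empty =>
    refine ⟨fun _ => [], fun l hl => ⟨[], by simp, ?_⟩⟩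
    cases l with
    | nil => exact .refl _
    | cons τ l =>
      obtain ⟨x, hx, _⟩ := hl τ (by simp)
      simp at hx
  | insert a S ha ih =>
    obtain ⟨canon, hcanon⟩ := ih
    refine ⟨fun c => if c a = a then canon c else
      canon (c * swap a (c⁻¹ a)) ++ [swap a (c⁻¹ a)], fun l hl => ?_⟩
    obtain ⟨A, B, t, hc, hA, ht, hB⟩ := exists_stdConnected_isolate ha hl
    obtain ⟨t', ht', hc'⟩ := hcanon A hA
    refine ⟨t' ++ t, fun τ hτ => (List.mem_append.1 hτ).elim (ht' τ) (ht τ), ?_⟩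
    have c₁ := hc'.append_right (B ++ doubled t)
    have c₂ := (StdConnected.doubled_comm (fun x hx => (ht' x hx).mul_self) B).append
      (canon A.prod) (doubled t)
    have c : StdConnected l (canon A.prod ++ B ++ doubled (t' ++ t)) := by
      simp only [List.append_assoc, doubled_append] at hc c₁ c₂ ⊢
      exact hc.trans (c₁.trans c₂)
    have hp : l.prod = A.prod * B.prod := by
      rw [← hc.prod_eq, List.prod_append, List.prod_append,
        prod_doubled fun x hx => (ht x hx).mul_self, mul_one]
    have hAa := prod_apply_of_notMem hA ha
    rcases hB with rfl | ⟨b, hb, rfl⟩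
    · rw [List.prod_nil, mul_one] at hp
      simp only [hp, if_pos hAa]
      simpa using c
    · have hab : a ≠ b := fun h => ha (h ▸ hb)
      rw [List.prod_singleton] at hp
      have hlb : l.prod⁻¹ a = b := by
        rw [Perm.inv_eq_iff_eq, hp, Perm.mul_apply, swap_apply_right, hAa]
      have hla : l.prod a ≠ a := by
        intro h
        rw [← Perm.eq_inv_iff_eq, hlb] at h
        exact hab h
      simp only [if_neg hla, hlb]
      rwa [hp, mul_assoc, swap_mul_self, mul_one]

end Swaps

/-- Two lists of transpositions of the same length, both generating the full symmetric
group and with the same product, are connected by standard moves. -/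
theorem stdConnected_of_generating_same_prod (n : ℕ)
    (l l' : List (Equiv.Perm (Fin n)))
    (hswap : ∀ τ ∈ l, τ.IsSwap) (hswap' : ∀ τ ∈ l', τ.IsSwap)
    (hlen : l.length = l'.length)
    (hgen : Subgroup.closure {τ | τ ∈ l} = ⊤)
    (hgen' : Subgroup.closure {τ | τ ∈ l'} = ⊤)
    (hprod : l.prod = l'.prod) :
    StdConnected l l' := by
  obtain ⟨canon, hcanon⟩ := exists_canonical (Finset.univ : Finset (Fin n))
  have hon : ∀ τ : Equiv.Perm (Fin n), τ.IsSwap → IsSwapOn Finset.univ τ := by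
    rintro τ ⟨x, y, hxy, rfl⟩
    exact ⟨x, Finset.mem_univ x, y, Finset.mem_univ y, hxy, rfl⟩
  obtain ⟨t, ht, hc⟩ := hcanon l fun τ hτ => hon τ (hswap τ hτ)
  obtain ⟨t', ht', hc'⟩ := hcanon l' fun τ hτ => hon τ (hswap' τ hτ)
  rw [← hprod] at hc'
  have hm : ∀ τ ∈ canon l.prod, τ.IsSwap := fun τ hτ =>
    hc.isSwap hswap τ (List.mem_append_left _ hτ)
  have hl := hc.length_eq
  have hl' := hc'.length_eq
  rw [List.length_append, length_doubled] at hl hl'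
  have hg := hc.symm.closure_le
  have hg' := hc'.symm.closure_le
  rw [hgen, top_le_iff] at hg
  rw [hgen', top_le_iff] at hg'
  refine hc.trans (StdConnected.trans ?_ hc'.symm)
  exact stdConnected_append_doubled hm ht' ht (by omega) (by simpa using hg') (by simpa using hg)
end

section
/- Let σ and τ be permutations of Fin n with N(σ·τ) = N(σ) + N(τ). Then every cycle of the cycle decomposition of σ is contained in some cycle of the cycle decomposition of σ·τ; that is, for all i, j : Fin n, if σ.SameCycle i j then (σ·τ).SameCycle i j. -/
/-- Word-length norm of a permutation with respect to the set of all transpositions: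
the least `m` such that `σ` is a product of `m` transpositions. -/
noncomputable def permNorm {n : ℕ} (σ : Equiv.Perm (Fin n)) : ℕ :=
  sInf {m | ∃ l : List (Equiv.Perm (Fin n)), (∀ τ ∈ l, τ.IsSwap) ∧ l.prod = σ ∧ l.length = m}

open Equiv Equiv.Perm Module

/-- The rational functions on `α` that are invariant under the permutation `σ`. -/
def invariantFunctions {α : Type*} (σ : Perm α) : Submodule ℚ (α → ℚ) where
  carrier := {f | ∀ x, f (σ x) = f x}
  add_mem' hf hg x := by simp [hf x, hg x]
  zero_mem' _ := rfl
  smul_mem' c f hf x := by simp [hf x]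

section invariantFunctions

variable {α : Type*} {σ τ : Perm α} {f : α → ℚ}

theorem invariantFunctions_one : invariantFunctions (1 : Perm α) = ⊤ :=
  eq_top_iff.2 fun _ _ _ => rfl

theorem inf_invariantFunctions_le_mul (σ τ : Perm α) :
    invariantFunctions σ ⊓ invariantFunctions τ ≤ invariantFunctions (σ * τ) :=
  fun _ hf x => (hf.1 (τ x)).trans (hf.2 x)

theorem apply_eq_of_sameCycle [Finite α] (hf : f ∈ invariantFunctions σ) {i j : α}
    (h : σ.SameCycle i j) : f j = f i := by
  obtain ⟨m, rfl⟩ := h.exists_nat_pow_eq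
  induction m with
  | zero => rfl
  | succ m ih => rw [pow_succ', Perm.mul_apply, hf, ih ⟨m, rfl⟩]

theorem sameCycle_of_invariantFunctions_le [Finite α]
    (h : invariantFunctions τ ≤ invariantFunctions σ) {i j : α} (hij : σ.SameCycle i j) :
    τ.SameCycle i j := by
  classical
  have hf : (fun x => if τ.SameCycle i x then (1 : ℚ) else 0) ∈ invariantFunctions τ := by
    intro x
    simp [sameCycle_apply_right]
  by_contra hj
  simpa [hj, SameCycle.refl] using apply_eq_of_sameCycle (h hf) hij

theorem invariantFunctions_lt_swap_mul [DecidableEq α] {a : α} (ha : σ a ≠ a) :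
    invariantFunctions σ < invariantFunctions (swap a (σ a) * σ) := by
  rw [SetLike.lt_iff_le_and_exists]
  refine ⟨fun f hf x => ?_, Pi.single a 1, fun x => ?_, fun h => ?_⟩
  · rw [Perm.mul_apply, ← hf x]
    by_cases hxa : σ x = a
    · rw [hxa, swap_apply_left, hf]
    · by_cases hx : σ x = σ a
      · rw [hx, swap_apply_right, hf]
      · rw [swap_apply_of_ne_of_ne hxa hx]
  · have hfix : (swap a (σ a) * σ) x = a ↔ x = a := by
      rw [← (swap a (σ a) * σ).injective.eq_iff (a := x)]
      simp
    simp only [Pi.single_apply, hfix]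
  · simpa [Pi.single_apply, ha] using h a

variable [Fintype α]

theorem finrank_invariantFunctions_add_le (σ τ : Perm α) :
    finrank ℚ (invariantFunctions σ) + finrank ℚ (invariantFunctions τ) ≤
      Fintype.card α + finrank ℚ ↥(invariantFunctions σ ⊓ invariantFunctions τ) := by
  rw [← Submodule.finrank_sup_add_finrank_inf_eq, ← finrank_fintype_fun_eq_card ℚ]
  exact Nat.add_le_add_right (Submodule.finrank_le _) _

variable [DecidableEq α]

theorem card_le_finrank_invariantFunctions_of_isSwap (h : σ.IsSwap) :
    Fintype.card α ≤ 1 + finrank ℚ (invariantFunctions σ) := by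
  obtain ⟨a, b, -, rfl⟩ := h
  let φ : (α → ℚ) →ₗ[ℚ] ℚ := LinearMap.proj (R := ℚ) (φ := fun _ => ℚ) a - LinearMap.proj b
  have hle : LinearMap.ker φ ≤ invariantFunctions (swap a b) := by
    intro f hf x
    have hab : f a = f b := sub_eq_zero.1 hf
    by_cases hxa : x = a
    · simp [hxa, hab]
    · by_cases hxb : x = b
      · simp [hxb, hab]
      · rw [swap_apply_of_ne_of_ne hxa hxb]
  have hker := Submodule.finrank_mono hle
  have hrange : finrank ℚ (LinearMap.range φ) ≤ 1 :=
    (Submodule.finrank_le _).trans (finrank_self ℚ).le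
  have hsum := φ.finrank_range_add_finrank_ker
  rw [finrank_fintype_fun_eq_card] at hsum
  omega

theorem card_le_length_add_finrank_invariantFunctions (l : List (Perm α))
    (hl : ∀ τ ∈ l, τ.IsSwap) :
    Fintype.card α ≤ l.length + finrank ℚ (invariantFunctions l.prod) := by
  induction l with
  | nil =>
    rw [List.prod_nil, invariantFunctions_one, finrank_top, finrank_fintype_fun_eq_card]
    exact Nat.le_add_left _ _
  | cons s l ih =>
    rw [List.forall_mem_cons] at hl
    have h₁ := card_le_finrank_invariantFunctions_of_isSwap hl.1
    have h₂ := ih hl.2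
    have h₃ := finrank_invariantFunctions_add_le s l.prod
    have h₄ := Submodule.finrank_mono (inf_invariantFunctions_le_mul s l.prod)
    rw [List.prod_cons, List.length_cons]
    omega

theorem exists_isSwap_list_length_add_finrank_le (σ : Perm α) :
    ∃ l : List (Perm α), (∀ τ ∈ l, τ.IsSwap) ∧ l.prod = σ ∧
      l.length + finrank ℚ (invariantFunctions σ) ≤ Fintype.card α := by
  induction hk : Fintype.card α - finrank ℚ (invariantFunctions σ) using Nat.strong_induction_on
    generalizing σ with
  | _ k ih =>
    have hcard (ρ : Perm α) : finrank ℚ (invariantFunctions ρ) ≤ Fintype.card α :=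
      (Submodule.finrank_le _).trans (finrank_fintype_fun_eq_card ℚ).le
    by_cases hσ : σ = 1
    · exact ⟨[], by simp, by simp [hσ], by simpa using hcard σ⟩
    · obtain ⟨a, ha⟩ : ∃ a, σ a ≠ a := by
        by_contra! h
        exact hσ (Equiv.ext h)
      have hlt := Submodule.finrank_lt_finrank_of_lt (invariantFunctions_lt_swap_mul ha)
      have hle := hcard (swap a (σ a) * σ)
      obtain ⟨l, hl, hprod, hlen⟩ := ih _ (by omega) (swap a (σ a) * σ) rfl
      refine ⟨swap a (σ a) :: l, List.forall_mem_cons.2 ⟨⟨a, σ a, ha.symm, rfl⟩, hl⟩, ?_, ?_⟩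
      · rw [List.prod_cons, hprod, swap_mul_self_mul]
      · rw [List.length_cons]
        omega

end invariantFunctions

theorem permNorm_add_finrank_invariantFunctions {n : ℕ} (σ : Perm (Fin n)) :
    permNorm σ + finrank ℚ (invariantFunctions σ) = n := by
  obtain ⟨l, hl, hprod, hlen⟩ := exists_isSwap_list_length_add_finrank_le σ
  have hle : permNorm σ ≤ l.length := Nat.sInf_le ⟨l, hl, hprod, rfl⟩
  obtain ⟨l', hl', hprod', hlen'⟩ : permNorm σ ∈ {m | ∃ l : List (Perm (Fin n)),
      (∀ τ ∈ l, τ.IsSwap) ∧ l.prod = σ ∧ l.length = m} :=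
    Nat.sInf_mem ⟨_, l, hl, hprod, rfl⟩
  have hge := card_le_length_add_finrank_invariantFunctions l' hl'
  rw [hprod', hlen'] at hge
  rw [Fintype.card_fin] at hlen hge
  omega

/-- If `N(στ) = N(σ) + N(τ)`, then every cycle of `σ` is contained in a cycle of `στ`. -/
theorem sameCycle_mul_of_permNorm_add (n : ℕ) (σ τ : Equiv.Perm (Fin n))
    (h : permNorm (σ * τ) = permNorm σ + permNorm τ) :
    ∀ i j : Fin n, σ.SameCycle i j → (σ * τ).SameCycle i j := by
  intro i j hij
  have hσ := permNorm_add_finrank_invariantFunctions σ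
  have hτ := permNorm_add_finrank_invariantFunctions τ
  have hστ := permNorm_add_finrank_invariantFunctions (σ * τ)
  have hinf := finrank_invariantFunctions_add_le σ τ
  rw [Fintype.card_fin] at hinf
  have heq := Submodule.eq_of_le_of_finrank_le (inf_invariantFunctions_le_mul σ τ) (by omega)
  exact sameCycle_of_invariantFunctions_le (heq ▸ inf_le_left) hij
end
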